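/- arXiv:1507.05303 — 2 statements merged into one kernel-verified Lean document; each statement's English description precedes it below -/
import Mathlib

section
/- Let k be an algebraically closed field of prime characteristic p and let X be a p×p matrix over k with trace 0. Then the k-subspace {Y ∈ M_p(k) : trace Y = 0 and X*Y = Y*X} has k-dimension p if and only if X has a single Jordan block of size p, i.e. there exists λ ∈ k such that (X − λ•1)^p = 0 and (X − λ•1)^(p−1) ≠ 0. -/
/-- For a `p × p` matrix `X`, the subspace of trace-zero matrices commuting with `X`
(the centraliser of `X` in `sl_p`). -/
def slCentralizer (p : ℕ) (k : Type*) [Field k]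
    (X : Matrix (Fin p) (Fin p) k) : Submodule k (Matrix (Fin p) (Fin p) k) where
  carrier := {Y | Matrix.trace Y = 0 ∧ X * Y = Y * X}
  zero_mem' := ⟨by simp, by simp⟩
  add_mem' := by
    rintro Y Z ⟨hY1, hY2⟩ ⟨hZ1, hZ2⟩
    exact ⟨by rw [Matrix.trace_add, hY1, hZ1, add_zero],
      by rw [mul_add, add_mul, hY2, hZ2]⟩
  smul_mem' := by
    rintro a Y ⟨h1, h2⟩
    exact ⟨by rw [Matrix.trace_smul, h1, smul_zero],
      by rw [mul_smul_comm, smul_mul_assoc, h2]⟩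

/-- The rank of an alternating bilinear form is even. -/
theorem even_rank_of_alt {k V : Type*} [Field k] [AddCommGroup V] [Module k V]
    [FiniteDimensional k V] (n : ℕ) : ∀ (B : V →ₗ[k] V →ₗ[k] k), (∀ x, B x x = 0) →
    Module.finrank k (LinearMap.ker B) + n = Module.finrank k V → Even n := by
  induction n using Nat.strong_induction_on with
  | _ n ih =>
    intro B hB hn
    by_cases h0 : B = 0
    · subst h0
      rw [LinearMap.ker_zero, finrank_top] at hn
      have : n = 0 := by omega
      simp [this]
    have hskew : ∀ u w, B u w = - B w u := by
      intro u w
      have h := hB (u + w)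
      simp only [map_add, LinearMap.add_apply, hB, zero_add, add_zero] at h
      linear_combination h
    obtain ⟨x, y, hxy⟩ : ∃ x y, B x y = 1 := by
      by_contra hcon
      apply h0
      ext x y
      by_contra hne
      exact hcon ⟨x, (B x y)⁻¹ • y, by
        rw [map_smul, smul_eq_mul]; exact inv_mul_cancel₀ hne⟩
    let B' : V →ₗ[k] V →ₗ[k] k :=
      B - (B.flip y).smulRight (B x) + (B.flip x).smulRight (B y)
    have hB' : ∀ u w, B' u w = B u w - B u y * B x w + B u x * B y w := by
      intro u w
      simp [B']
    have hyx : B y x = -1 := by rw [hskew, hxy]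
    have halt : ∀ u, B' u u = 0 := by
      intro u
      rw [hB', hB, hskew u y, hskew u x]; ring
    have hle : LinearMap.ker B ≤ LinearMap.ker B' := by
      intro u hu
      rw [LinearMap.mem_ker] at hu ⊢
      ext w
      rw [hB', hu]; simp
    let φ : LinearMap.ker B' →ₗ[k] k × k :=
      ((B.flip x).prod (B.flip y)).comp (LinearMap.ker B').subtype
    have hφ : ∀ u, φ u = (B u x, B u y) := fun u => rfl
    have hxm : x ∈ LinearMap.ker B' := by
      rw [LinearMap.mem_ker]; ext w; rw [hB', hxy, hB]; simp
    have hym : y ∈ LinearMap.ker B' := by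
      rw [LinearMap.mem_ker]; ext w; rw [hB', hyx, hB]; simp
    have hsurj : LinearMap.range φ = ⊤ := by
      rw [LinearMap.range_eq_top]
      rintro ⟨a, b⟩
      refine ⟨b • ⟨x, hxm⟩ - a • ⟨y, hym⟩, ?_⟩
      rw [hφ]
      simp [hxy, hyx, hB]
    have hker : LinearMap.ker φ = (LinearMap.ker B).comap (LinearMap.ker B').subtype := by
      ext ⟨u, hu⟩
      rw [LinearMap.mem_ker, hφ, Submodule.mem_comap, LinearMap.mem_ker]
      constructor
      · intro h
        have h1 : B u x = 0 := congrArg Prod.fst h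
        have h2 : B u y = 0 := congrArg Prod.snd h
        ext w
        have h3 : B' u w = 0 := by rw [LinearMap.mem_ker.1 hu]; rfl
        rw [hB', h1, h2] at h3
        simpa using h3
      · intro h
        have h' : B u = 0 := h
        simp [h']
    have hrn := LinearMap.finrank_range_add_finrank_ker φ
    rw [hsurj, finrank_top, hker, (Submodule.comapSubtypeEquivOfLe hle).finrank_eq,
      Module.finrank_prod, Module.finrank_self] at hrn
    have hle2 := Submodule.finrank_le (LinearMap.ker B')
    obtain ⟨m, rfl⟩ : ∃ m, n = m + 2 := ⟨n - 2, by omega⟩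
    have := ih m (by omega) B' halt (by omega)
    exact this.add (by decide)

/-- The commutant as a submodule. -/
def glCent (p : ℕ) (k : Type*) [Field k] (X : Matrix (Fin p) (Fin p) k) :
    Submodule k (Matrix (Fin p) (Fin p) k) :=
  LinearMap.ker (LinearMap.mulLeft k X - LinearMap.mulRight k X)

theorem mem_glCent (p : ℕ) (k : Type*) [Field k] (X Y : Matrix (Fin p) (Fin p) k) :
    Y ∈ glCent p k X ↔ X * Y = Y * X := by
  simp [glCent, sub_eq_zero]

theorem mem_slCentralizer (p : ℕ) (k : Type*) [Field k] (X Y : Matrix (Fin p) (Fin p) k) :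
    Y ∈ slCentralizer p k X ↔ Matrix.trace Y = 0 ∧ X * Y = Y * X := Iff.rfl

theorem even_glCent (p : ℕ) (k : Type*) [Field k] (X : Matrix (Fin p) (Fin p) k) (n : ℕ)
    (h : Module.finrank k (glCent p k X) + n = p * p) : Even n := by
  let B : Matrix (Fin p) (Fin p) k →ₗ[k] Matrix (Fin p) (Fin p) k →ₗ[k] k :=
    LinearMap.mk₂ k (fun Y Z => Matrix.trace ((X * Y - Y * X) * Z))
      (by intros; rw [← Matrix.trace_add]; congr 1; noncomm_ring)
      (by intros; rw [← Matrix.trace_smul, mul_smul_comm, smul_mul_assoc, ← smul_sub,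
            smul_mul_assoc])
      (by intros; simp only [mul_add, ← Matrix.trace_add])
      (by intros; rw [← Matrix.trace_smul, mul_smul_comm])
  have hB : ∀ Y Z, B Y Z = Matrix.trace ((X * Y - Y * X) * Z) := fun _ _ => rfl
  refine even_rank_of_alt n B ?_ ?_
  · intro Y
    rw [hB, sub_mul, Matrix.trace_sub, mul_assoc Y X Y, Matrix.trace_mul_comm Y (X * Y), sub_self]
  · have : LinearMap.ker B = glCent p k X := by
      ext Y
      rw [LinearMap.mem_ker, mem_glCent]
      constructor
      · intro h
        rw [← sub_eq_zero, Matrix.ext_iff_trace_mul_right]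
        intro Z
        rw [← hB, h]; simp
      · intro h
        ext1 Z
        rw [hB, h]; simp
    rw [this, h, Module.finrank_matrix]; simp

theorem finrank_glCent_of_trace (p : ℕ) (k : Type*) [Field k] (X Y : Matrix (Fin p) (Fin p) k)
    (hY : X * Y = Y * X) (ht : Matrix.trace Y ≠ 0) :
    Module.finrank k (glCent p k X) = Module.finrank k (slCentralizer p k X) + 1 := by
  let φ : glCent p k X →ₗ[k] k := (Matrix.traceLinearMap (Fin p) k k).comp (glCent p k X).subtype
  have hφ : ∀ u, φ u = Matrix.trace u.1 := fun u => rfl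
  have hle : slCentralizer p k X ≤ glCent p k X := fun Z hZ => (mem_glCent ..).2 hZ.2
  have hsurj : LinearMap.range φ = ⊤ := by
    rw [LinearMap.range_eq_top]
    apply LinearMap.surjective
    intro h
    apply ht
    have : φ ⟨Y, (mem_glCent ..).2 hY⟩ = 0 := by rw [h]; rfl
    exact this
  have hker : LinearMap.ker φ = (slCentralizer p k X).comap (glCent p k X).subtype := by
    ext ⟨u, hu⟩
    rw [LinearMap.mem_ker, hφ, Submodule.mem_comap]
    exact ⟨fun h => ⟨h, (mem_glCent ..).1 hu⟩, fun h => h.1⟩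
  have hrn := LinearMap.finrank_range_add_finrank_ker φ
  rw [hsurj, finrank_top, hker, (Submodule.comapSubtypeEquivOfLe hle).finrank_eq,
    Module.finrank_self] at hrn
  omega

/-- Noncommutative derivative of the `n`-th power in direction `E`. -/
def ncD {p : ℕ} {k : Type*} [Field k] (X E : Matrix (Fin p) (Fin p) k) :
    ℕ → Matrix (Fin p) (Fin p) k
  | 0 => 0
  | n + 1 => X * ncD X E n + E * X ^ n

theorem ncD_comm {p : ℕ} {k : Type*} [Field k] (X E : Matrix (Fin p) (Fin p) k) (n : ℕ) :
    X * ncD X E n - ncD X E n * X = X ^ n * E - E * X ^ n := by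
  induction n with
  | zero => simp [ncD]
  | succ n ih =>
    have h : X * ncD X E n = ncD X E n * X + (X ^ n * E - E * X ^ n) := by
      rw [← ih]; abel
    have h2 : X * (X * ncD X E n) = X * (ncD X E n) * X + (X ^ (n+1) * E - X * E * X ^ n) := by
      conv_lhs => rw [h]
      rw [pow_succ']; noncomm_ring
    rw [ncD, mul_add, h2, add_mul, mul_assoc E, ← pow_succ, mul_assoc X E]
    abel

theorem ncD_trace {p : ℕ} {k : Type*} [Field k] (X E : Matrix (Fin p) (Fin p) k) (n : ℕ) :
    ∀ j, Matrix.trace (ncD X E n * X ^ j) = n * Matrix.trace (E * X ^ (n - 1 + j)) := by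
  induction n with
  | zero => simp [ncD]
  | succ n ih =>
    intro j
    rw [ncD, add_mul, Matrix.trace_add, mul_assoc X, Matrix.trace_mul_comm X, mul_assoc,
      ← pow_succ, ih, mul_assoc, ← pow_add]
    rcases n with _ | n
    · simp
    · have : n + 1 - 1 + (j + 1) = n + 1 + 1 - 1 + j := by omega
      have h2 : n + 1 + j = n + 1 + 1 - 1 + j := by omega
      rw [this, h2]
      push_cast
      ring

open Polynomial in
theorem derivative_eq_zero {p : ℕ} {k : Type*} [Field k] (X : Matrix (Fin p) (Fin p) k)
    (h : ∀ Y, X * Y = Y * X → Matrix.trace Y = 0) : aeval X (derivative (minpoly k X)) = 0 := by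
  rw [Matrix.ext_iff_trace_mul_left]
  intro E
  set q := minpoly k X with hq
  have hq0 : aeval X q = 0 := minpoly.aeval k X
  rw [aeval_eq_sum_range] at hq0
  let Y := ∑ i ∈ Finset.range (q.natDegree + 1), q.coeff i • ncD X E i
  have hY : X * Y = Y * X := by
    rw [← sub_eq_zero]
    calc X * Y - Y * X
        = ∑ i ∈ Finset.range (q.natDegree + 1), q.coeff i • (X ^ i * E - E * X ^ i) := by
          simp only [Y, Finset.mul_sum, Finset.sum_mul, ← Finset.sum_sub_distrib,
            mul_smul_comm, smul_mul_assoc, ← smul_sub, ncD_comm]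
      _ = (∑ i ∈ Finset.range (q.natDegree + 1), q.coeff i • X ^ i) * E
          - E * ∑ i ∈ Finset.range (q.natDegree + 1), q.coeff i • X ^ i := by
          simp only [Finset.mul_sum, Finset.sum_mul, ← Finset.sum_sub_distrib,
            mul_smul_comm, smul_mul_assoc, ← smul_sub]
      _ = 0 := by rw [hq0]; simp
  have ht := h Y hY
  rw [mul_zero, Matrix.trace_zero, ← ht]
  have hd : derivative q = ∑ i ∈ Finset.range (q.natDegree + 1),
      C (q.coeff i * i) * Polynomial.X ^ (i - 1) := by
    rw [derivative_apply, sum_over_range]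
    intro n; simp
  rw [hd, map_sum, Finset.mul_sum, Matrix.trace_sum, Matrix.trace_sum]
  refine Finset.sum_congr rfl fun i _ => ?_
  have := ncD_trace X E i 0
  simp only [pow_zero, mul_one, add_zero] at this
  rw [Matrix.trace_smul, this]
  rw [map_mul, map_pow, aeval_X, aeval_C, ← Algebra.smul_def, mul_smul_comm, Matrix.trace_smul,
    smul_eq_mul, smul_eq_mul, mul_assoc]

open Polynomial in
theorem forward (p : ℕ) (hp : p.Prime) (k : Type*) [Field k] [IsAlgClosed k] [CharP k p]
    (X : Matrix (Fin p) (Fin p) k) (h : ∀ Y, X * Y = Y * X → Matrix.trace Y = 0) :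
    ∃ lam : k, (X - lam • (1 : Matrix (Fin p) (Fin p) k)) ^ p = 0 ∧
        (X - lam • (1 : Matrix (Fin p) (Fin p) k)) ^ (p - 1) ≠ 0 := by
  have := Fact.mk hp
  have hint : IsIntegral k X := Matrix.isIntegral X
  have hq : derivative (minpoly k X) = 0 := by
    by_contra hne
    have h1 := minpoly.degree_le_of_ne_zero k X hne (derivative_eq_zero X h)
    have h2 := degree_derivative_lt (minpoly.ne_zero hint)
    exact absurd h1 (not_le.2 h2)
  have hexp := expand_contract p hq hp.ne_zero
  set g := contract p (minpoly k X) with hg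
  have hdeg : (minpoly k X).natDegree ≤ p := by
    have := natDegree_le_of_dvd (Matrix.minpoly_dvd_charpoly X) X.charpoly_monic.ne_zero
    simpa [Matrix.charpoly_natDegree_eq_dim] using this
  have hpos := minpoly.natDegree_pos hint
  have hmon := minpoly.monic hint
  rw [← hexp, natDegree_expand] at hdeg hpos
  have hg1 : g.natDegree = 1 := by
    have : 0 < g.natDegree := Nat.pos_of_mul_pos_right hpos
    have : g.natDegree ≤ 1 := by
      by_contra hc
      have := hp.pos
      nlinarith
    omega
  have hgm : g.Monic := by
    rw [← hexp] at hmon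
    exact (monic_expand_iff hp.pos).1 hmon
  have hgX : g = Polynomial.X + C (g.coeff 0) := hgm.eq_X_add_C hg1
  obtain ⟨b, hb⟩ := IsAlgClosed.exists_pow_nat_eq (-g.coeff 0) hp.pos
  have hmp : minpoly k X = (Polynomial.X - C b) ^ p := by
    rw [← hexp, hgX, sub_pow_char, map_add, expand_X, expand_C, ← C_pow, hb]
    simp
  have hae : aeval X (Polynomial.X - C b) = X - b • (1 : Matrix (Fin p) (Fin p) k) := by
    simp [Algebra.algebraMap_eq_smul_one]
  refine ⟨b, ?_, ?_⟩
  · rw [← hae, ← map_pow, ← hmp, minpoly.aeval]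
  · rw [← hae, ← map_pow]
    intro h0
    have h1 := natDegree_le_natDegree
      (minpoly.degree_le_of_ne_zero k X (pow_ne_zero (p - 1) (X_sub_C_ne_zero b)) h0)
    rw [hmp] at h1
    simp only [natDegree_pow, natDegree_X_sub_C] at h1
    have := hp.pos
    omega

theorem backward (p : ℕ) (hp : p.Prime) (k : Type*) [Field k] [CharP k p]
    (X : Matrix (Fin p) (Fin p) k) (lam : k)
    (h1 : (X - lam • (1 : Matrix (Fin p) (Fin p) k)) ^ p = 0)
    (h2 : (X - lam • (1 : Matrix (Fin p) (Fin p) k)) ^ (p - 1) ≠ 0) :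
    Module.finrank k (slCentralizer p k X) = p := by
  have hpos := hp.pos
  set N := X - lam • (1 : Matrix (Fin p) (Fin p) k) with hN
  have hcomm : ∀ Y, X * Y = Y * X ↔ N * Y = Y * N := by
    intro Y
    simp [hN, sub_mul, mul_sub]
  obtain ⟨v, hv⟩ : ∃ v, Matrix.mulVec (N ^ (p - 1)) v ≠ 0 := by
    by_contra hcon
    push Not at hcon
    apply h2
    apply Matrix.toLin'.injective
    refine LinearMap.ext fun w => ?_
    rw [Matrix.toLin'_apply, hcon, map_zero, LinearMap.zero_apply]
  have hzero : ∀ m, p ≤ m → N ^ m = 0 := by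
    intro m hm
    exact pow_eq_zero_of_le hm h1
  have hli : LinearIndependent k (fun i : Fin p => Matrix.mulVec (N ^ (i : ℕ)) v) := by
    rw [Fintype.linearIndependent_iff]
    intro g hg
    have key : ∀ n, ∀ i : Fin p, (i : ℕ) = n → g i = 0 := by
      intro n
      induction n using Nat.strong_induction_on with
      | _ n ih =>
        intro i hi
        have h3 := congrArg (Matrix.mulVec (N ^ (p - 1 - n))) hg
        rw [Matrix.mulVec_sum, Matrix.mulVec_zero, Finset.sum_eq_single i] at h3
        · rw [Matrix.mulVec_smul, Matrix.mulVec_mulVec, ← pow_add,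
            show p - 1 - n + (i : ℕ) = p - 1 by have := i.2; omega] at h3
          exact (smul_eq_zero.1 h3).resolve_right hv
        · intro j _ hj
          rcases lt_or_gt_of_ne (fun h => hj (Fin.ext h) : (j : ℕ) ≠ i) with hlt | hgt
          · rw [ih j (by omega) j rfl]; simp
          · rw [Matrix.mulVec_smul, Matrix.mulVec_mulVec, ← pow_add,
              hzero _ (by have := j.2; omega)]; simp
        · simp
    exact fun i => key i i rfl
  apply le_antisymm
  · let φ : slCentralizer p k X →ₗ[k] (Fin p → k) :=
      { toFun := fun Y => Matrix.mulVec Y.1 v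
        map_add' := fun Y Z => Matrix.add_mulVec _ _ _
        map_smul' := fun a Y => Matrix.smul_mulVec _ _ _ }
    have hφ : Function.Injective φ := by
      rw [← LinearMap.ker_eq_bot, LinearMap.ker_eq_bot']
      rintro ⟨Y, hY⟩ h0
      have h0' : Matrix.mulVec Y v = 0 := h0
      have hc : Commute N Y := (hcomm Y).1 hY.2
      have hspan := hli.span_eq_top_of_card_eq_finrank' (by simp)
      apply Subtype.ext
      change Y = 0
      apply Matrix.toLin'.injective
      rw [map_zero]
      apply LinearMap.ext_on_range hspan
      intro i
      rw [Matrix.toLin'_apply, Matrix.mulVec_mulVec, ← (hc.pow_left i).eq, ← Matrix.mulVec_mulVec,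
        h0']
      simp
    simpa using LinearMap.finrank_le_finrank_of_injective hφ
  · let w : Fin p → slCentralizer p k X := fun i => ⟨N ^ (i : ℕ), by
      refine ⟨?_, (hcomm _).2 (Commute.self_pow N i).eq⟩
      rcases Nat.eq_zero_or_pos (i : ℕ) with hi | hi
      · rw [hi]; simp
      · refine (Matrix.isNilpotent_trace_of_isNilpotent ?_).eq_zero
        exact (IsNilpotent.pow_of_pos ⟨p, h1⟩ hi.ne')⟩
    have hw : LinearIndependent k w := by
      let ψ : slCentralizer p k X →ₗ[k] (Fin p → k) :=
        { toFun := fun Y => Matrix.mulVec Y.1 v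
          map_add' := fun Y Z => Matrix.add_mulVec _ _ _
          map_smul' := fun a Y => Matrix.smul_mulVec _ _ _ }
      exact LinearIndependent.of_comp ψ hli
    simpa using hw.fintype_card_le_finrank

/-- Over an algebraically closed field of characteristic `p > 0`, for a trace-zero `p × p`
matrix `X`, the centraliser of `X` in `sl_p` has dimension `p` if and only if `X` has a
single Jordan block of size `p`. -/
theorem finrank_slCentralizer_eq_iff_single_jordan_block
    (p : ℕ) (hp : p.Prime) (k : Type*) [Field k] [IsAlgClosed k] [CharP k p]
    (X : Matrix (Fin p) (Fin p) k) (htr : Matrix.trace X = 0) :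
    Module.finrank k (slCentralizer p k X) = p ↔
      ∃ lam : k, (X - lam • (1 : Matrix (Fin p) (Fin p) k)) ^ p = 0 ∧
        (X - lam • (1 : Matrix (Fin p) (Fin p) k)) ^ (p - 1) ≠ 0 := by
  constructor
  · intro hdim
    apply forward p hp k X
    intro Y hY
    by_contra ht
    have h1 := finrank_glCent_of_trace p k X Y hY ht
    rw [hdim] at h1
    have hle := Submodule.finrank_le (glCent p k X)
    rw [Module.finrank_matrix] at hle
    simp only [Fintype.card_fin, Module.finrank_self, mul_one] at hle
    have h2 := even_glCent p k X (p * p - (p + 1)) (by omega)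
    obtain ⟨r, hr⟩ := h2
    obtain ⟨s, hs⟩ := Nat.even_mul_succ_self p
    have : p * (p + 1) = p * p + p := by ring
    omega
  · rintro ⟨lam, h1, h2⟩
    exact backward p hp k X lam h1 h2
end

section
/- Let p be a prime and k a field of characteristic p. For n ≥ 1 let C_n be the n×n matrix over k with diagonal entries 2, entries −1 immediately above and below the diagonal, and all other entries 0 (the type-A_n Cartan matrix reduced modulo p). Then the rank of C_n equals n if p does not divide n + 1, and equals n − 1 if p divides n + 1. -/
/-- The Cartan matrix of the root system of type `A_n` with entries in a ring `k`:
diagonal entries `2`, entries `-1` immediately above and below the diagonal, all other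
entries `0`. -/
def cartanMatrixA' (k : Type*) [Ring k] (n : ℕ) : Matrix (Fin n) (Fin n) k :=
  Matrix.of fun i j =>
    if i = j then 2
    else if (i : ℕ) + 1 = (j : ℕ) ∨ (j : ℕ) + 1 = (i : ℕ) then -1
    else 0

/-- Action of the Cartan matrix on a vector extended by zero at both ends. -/
theorem cartanA_mulVec {k : Type*} [Field k] (n : ℕ) (V : ℕ → k) (h0 : V 0 = 0)
    (h1 : V (n + 1) = 0) (i : Fin n) :
    (cartanMatrixA' k n).mulVec (fun j => V (j + 1)) i
      = 2 * V (i + 1) - V i - V (i + 2) := by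
  obtain ⟨i, hi⟩ := i
  have e : ∀ j : Fin n, cartanMatrixA' k n ⟨i, hi⟩ j * V (j + 1)
      = (fun j : ℕ => (if i = j then 2 * V (j + 1) else 0)
        - (if i + 1 = j then V (j + 1) else 0)
        - (if i = j + 1 then V (j + 1) else 0)) j := by
    intro j
    obtain ⟨j, hj⟩ := j
    simp only [cartanMatrixA', Matrix.of_apply, Fin.mk.injEq]
    split_ifs <;> first | omega | simp
  simp only [Matrix.mulVec, dotProduct]
  rw [Finset.sum_congr rfl (fun j _ => e j), Fin.sum_univ_eq_sum_range
    (fun j : ℕ => (if i = j then 2 * V (j + 1) else 0)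
        - (if i + 1 = j then V (j + 1) else 0)
        - (if i = j + 1 then V (j + 1) else 0)) n,
    Finset.sum_sub_distrib, Finset.sum_sub_distrib]
  have a1 : ∑ j ∈ Finset.range n, (if i = j then 2 * V (j + 1) else 0) = 2 * V (i + 1) := by
    rw [Finset.sum_ite_eq, if_pos (Finset.mem_range.2 hi)]
  have a2 : ∑ j ∈ Finset.range n, (if i + 1 = j then V (j + 1) else 0) = V (i + 2) := by
    rw [Finset.sum_ite_eq]
    split_ifs with h
    · rfl
    · have : i + 1 = n := by
        simp only [Finset.mem_range] at h
        omega
      rw [← this] at h1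
      exact h1.symm
  have a3 : ∑ j ∈ Finset.range n, (if i = j + 1 then V (j + 1) else 0) = V i := by
    cases i with
    | zero => simp [h0]
    | succ m =>
      simp only [Nat.add_right_cancel_iff]
      rw [Finset.sum_ite_eq, if_pos (Finset.mem_range.2 (by omega))]
  rw [a1, a2, a3]
  ring

/-- A vector in the kernel is an arithmetic progression, whose next term vanishes. -/
theorem cartanA_ker {k : Type*} [Field k] (n : ℕ) (hn : 1 ≤ n) (v : Fin n → k)
    (hv : (cartanMatrixA' k n).mulVec v = 0) :
    (∀ j : Fin n, v j = ((j : ℕ) + 1 : k) * v ⟨0, hn⟩) ∧ ((n : k) + 1) * v ⟨0, hn⟩ = 0 := by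
  let V : ℕ → k := fun j => if h : 1 ≤ j ∧ j ≤ n then v ⟨j - 1, by omega⟩ else 0
  have hV : v = fun j : Fin n => V (j + 1) := by
    funext j
    have := j.2
    simp only [V]
    rw [dif_pos (by omega)]
    rfl
  have h0 : V 0 = 0 := by simp [V]
  have h1 : V (n + 1) = 0 := by simp [V]
  have hrec : ∀ i < n, V (i + 2) = 2 * V (i + 1) - V i := by
    intro i hi
    have := cartanA_mulVec n V h0 h1 ⟨i, hi⟩
    rw [← hV, hv] at this
    simp only [Pi.zero_apply] at this
    linear_combination this
  have key : ∀ j, j ≤ n → V j = j * V 1 ∧ V (j + 1) = (j + 1 : k) * V 1 := by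
    intro j
    induction j with
    | zero => intro _; simp [h0]
    | succ j ih =>
      intro hj
      obtain ⟨b1, b2⟩ := ih (by omega)
      refine ⟨by push_cast; exact b2, ?_⟩
      rw [hrec j (by omega), b1, b2]
      push_cast
      ring
  have hv0 : v ⟨0, hn⟩ = V 1 := congrFun hV ⟨0, hn⟩
  rw [hv0]
  refine ⟨fun j => ?_, ?_⟩
  · rw [congrFun hV j]
    exact (key j j.2.le).2
  · rw [← (key n le_rfl).2, h1]

/-- Over a field of characteristic `p`, the type `A_n` Cartan matrix has rank `n` if
`p ∤ n + 1`, and rank `n - 1` if `p ∣ n + 1`. -/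
theorem rank_cartanMatrixA_charP
    (p : ℕ) (hp : p.Prime) (k : Type*) [Field k] [CharP k p] (n : ℕ) (hn : 1 ≤ n) :
    (¬ p ∣ n + 1 → (cartanMatrixA' k n).rank = n) ∧
      (p ∣ n + 1 → (cartanMatrixA' k n).rank = n - 1) := by
  have hz : ((n : k) + 1 = 0) ↔ p ∣ n + 1 := by
    rw [← CharP.cast_eq_zero_iff k p]
    push_cast
    rfl
  have rn := LinearMap.finrank_range_add_finrank_ker (cartanMatrixA' k n).mulVecLin
  rw [Module.finrank_fin_fun] at rn
  change (cartanMatrixA' k n).rank + _ = n at rn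
  refine ⟨fun h => ?_, fun h => ?_⟩
  · have hk : LinearMap.ker (cartanMatrixA' k n).mulVecLin = ⊥ := by
      rw [LinearMap.ker_eq_bot']
      intro v hv
      obtain ⟨c1, c2⟩ := cartanA_ker n hn v hv
      have h0 : v ⟨0, hn⟩ = 0 := (mul_eq_zero.1 c2).resolve_left (fun h' => h (hz.1 h'))
      funext j
      rw [c1 j, h0, mul_zero]
      rfl
    rw [hk, finrank_bot] at rn
    exact rn
  · let w : Fin n → k := fun j => (((j : ℕ) + 1 : ℕ) : k)
    have hw : w ≠ 0 := by
      intro h'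
      have := congrFun h' ⟨0, hn⟩
      simp [w] at this
    have hk : LinearMap.ker (cartanMatrixA' k n).mulVecLin = Submodule.span k {w} := by
      apply le_antisymm
      · intro v hv
        obtain ⟨c1, -⟩ := cartanA_ker n hn v hv
        rw [Submodule.mem_span_singleton]
        refine ⟨v ⟨0, hn⟩, ?_⟩
        funext j
        rw [c1 j]
        simp [w, mul_comm]
      · rw [Submodule.span_singleton_le_iff_mem, LinearMap.mem_ker]
        funext i
        rw [Matrix.mulVecLin_apply]
        refine (cartanA_mulVec n (fun j => (j : k)) (by simp)
          (by push_cast; exact hz.2 h) i).trans ?_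
        push_cast
        simp only [Pi.zero_apply]
        ring
    rw [hk, finrank_span_singleton hw] at rn
    omega
end
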